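/- arXiv:2410.13108 — 2 statements merged into one kernel-verified Lean document; each statement's English description precedes it below -/
import Mathlib

section
/- Suppose the demand function f has complexity k for some finite k ≥ 1. If g is an optimal simple policy and g(x) = C_E for some x ∈ ℝ (i.e., g holds the user state constant at x), then f is discontinuous at x. Equivalently, a simple policy that holds the user state constant at a point where f is continuous is not optimal. -/
noncomputable section

open Filter Topology

/-- The modified demand function `f̃` built from the demand function `f`,
discount `γ` and friction `c`. -/
def ftilde (γ c : ℝ) (f : ℝ → ℝ) (x : ℝ) : ℝ :=
  f x + ((1 - f x) * (1 - c) * f x * γ) / (1 - γ * (1 - (1 - c) * f x))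

/-- States generated by an action sequence `a` from initial state `x0`:
`stTraj CE a x0 (t-1)` is the paper's `x_t`, so `stTraj CE a x0 0 = x0` is `x₁`. -/
def stTraj (CE : ℝ) (a : ℕ → ℝ) (x0 : ℝ) : ℕ → ℝ
  | 0 => x0
  | n + 1 => stTraj CE a x0 n + CE - a n

/-- (Discounted) payoff `J_{x0}(a)` of the action sequence `a` from initial state `x0`:
`Σ_{t=1}^∞ (C_R + a_t)·Π_{τ=2}^{t} (γ·f̃(x_τ))`. -/
def payoff (γ c CR CE : ℝ) (f : ℝ → ℝ) (x0 : ℝ) (a : ℕ → ℝ) : ℝ :=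
  ∑' t : ℕ, (CR + a t) *
    ∏ τ ∈ Finset.range t, (γ * ftilde γ c f (stTraj CE a x0 (τ + 1)))

/-- Trajectory induced by a simple policy `g` from initial state `x0`:
`polTraj CE g x0 (t-1)` is the paper's `x_t`. -/
def polTraj (CE : ℝ) (g : ℝ → ℝ) (x0 : ℝ) : ℕ → ℝ
  | 0 => x0
  | n + 1 => polTraj CE g x0 n + CE - g (polTraj CE g x0 n)

/-- Payoff `J_{x0}(g)` of the simple policy `g` from initial state `x0`. -/
def polPayoff (γ c CR CE : ℝ) (f : ℝ → ℝ) (g : ℝ → ℝ) (x0 : ℝ) : ℝ :=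
  payoff γ c CR CE f x0 (fun n => g (polTraj CE g x0 n))

/-- An action sequence takes values in `[-K, K]`. -/
def IsActionSeq (K : ℝ) (a : ℕ → ℝ) : Prop := ∀ n, a n ∈ Set.Icc (-K) K

/-- A simple policy takes values in `[-K, K]`. -/
def IsSimplePolicy (K : ℝ) (g : ℝ → ℝ) : Prop := ∀ x, g x ∈ Set.Icc (-K) K

/-- A simple policy `g` is optimal if from every initial state it weakly dominates
every action sequence. -/
def IsOptimal (γ c CR CE K : ℝ) (f : ℝ → ℝ) (g : ℝ → ℝ) : Prop :=
  IsSimplePolicy K g ∧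
  ∀ x0 : ℝ, ∀ a : ℕ → ℝ, IsActionSeq K a →
    payoff γ c CR CE f x0 a ≤ polPayoff γ c CR CE f g x0

/-- `f` has complexity `k`: it is piecewise constant with breakpoints `b₁ < … < b_k`,
constant on `(−∞,b₁)` and on each `[bᵢ, b_{i+1})` and `[b_k, ∞)`. -/
def HasComplexity (f : ℝ → ℝ) (k : ℕ) : Prop :=
  ∃ b : Fin k → ℝ, StrictMono b ∧
    (∀ x y : ℝ, (∀ j : Fin k, x < b j) → (∀ j : Fin k, y < b j) → f x = f y) ∧
    (∀ i : Fin k, ∀ x y : ℝ, b i ≤ x → b i ≤ y →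
      (∀ j : Fin k, i < j → x < b j) → (∀ j : Fin k, i < j → y < b j) → f x = f y)

/-- The value function `V(x)`: supremum of payoffs of action sequences from `x`. -/
def V (γ c CR CE K : ℝ) (f : ℝ → ℝ) (x : ℝ) : ℝ :=
  sSup {v : ℝ | ∃ a : ℕ → ℝ, IsActionSeq K a ∧ payoff γ c CR CE f x a = v}

/-- The Q-function `Q(i,x) = C_R + i + γ·f̃(x + C_E − i)·V(x + C_E − i)`. -/
def Q (γ c CR CE K : ℝ) (f : ℝ → ℝ) (i x : ℝ) : ℝ :=
  CR + i + γ * ftilde γ c f (x + CE - i) * V γ c CR CE K f (x + CE - i)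

lemma finite_range_of_complexity (f : ℝ → ℝ) (k : ℕ) (h : HasComplexity f k) :
    (Set.range f).Finite := by
  classical
  obtain ⟨b, hb, h0, h1⟩ := h
  let S : ℝ → Finset (Fin k) := fun x => Finset.univ.filter (fun j => b j ≤ x)
  have key : Function.FactorsThrough f S := by
    intro x y hxy
    have hiff : ∀ j, b j ≤ x ↔ b j ≤ y := by
      intro j
      have := congrArg (fun T => j ∈ T) hxy
      simpa [S] using this
    by_cases hne : (S x).Nonempty
    · have hm := (S x).max'_mem hne
      have hx : b ((S x).max' hne) ≤ x := by simpa [S] using hm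
      have hlt : ∀ j, (S x).max' hne < j → x < b j := by
        intro j hj
        by_contra hcon
        have hjm : j ∈ S x := by simpa [S] using hcon
        exact absurd ((S x).le_max' j hjm) (not_le.mpr hj)
      refine h1 _ x y hx ((hiff _).1 hx) hlt ?_
      intro j hj
      exact not_le.mp fun hc => absurd ((hiff j).2 hc) (not_le.mpr (hlt j hj))
    · have hlt : ∀ j, x < b j := by
        intro j
        by_contra hcon
        exact hne ⟨j, by simpa [S] using hcon⟩
      refine h0 x y hlt ?_
      intro j
      exact not_le.mp fun hc => absurd ((hiff j).2 hc) (not_le.mpr (hlt j))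
  have e : Function.extend S f 0 ∘ S = f := funext fun x => key.extend_apply 0 x
  rw [← e]
  exact (Set.finite_range _).subset (Set.range_comp_subset_range _ _)

lemma ftilde_mem (γ c : ℝ) (f : ℝ → ℝ) (x : ℝ)
    (hγ : γ ∈ Set.Ioo (0:ℝ) 1) (hc : c ∈ Set.Icc (0:ℝ) 1) (hf : f x ∈ Set.Icc (0:ℝ) 1) :
    0 ≤ ftilde γ c f x ∧ ftilde γ c f x ≤ 1 := by
  obtain ⟨g0, g1⟩ := hγ
  obtain ⟨c0, c1⟩ := hc
  obtain ⟨f0, f1⟩ := hf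
  unfold ftilde
  have hp : 0 ≤ (1 - c) * f x := mul_nonneg (by linarith) f0
  have hp2 : 0 ≤ γ * ((1 - c) * f x) := mul_nonneg g0.le hp
  have hd : 0 < 1 - γ * (1 - (1 - c) * f x) := by nlinarith
  have hn : 0 ≤ (1 - f x) * (1 - c) * f x * γ := by
    have := mul_nonneg (sub_nonneg.2 f1) hp2
    nlinarith
  constructor
  · have := div_nonneg hn hd.le
    linarith
  · have : ((1 - f x) * (1 - c) * f x * γ) / (1 - γ * (1 - (1 - c) * f x)) ≤ 1 - f x := by
      rw [div_le_iff₀ hd]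
      have := mul_nonneg (sub_nonneg.2 f1) (sub_nonneg.2 g1.le)
      nlinarith
    linarith

/-- An optimal simple policy only holds the user state constant at discontinuities of `f`. -/
theorem stmt3 (γ c CR CE K : ℝ) (f : ℝ → ℝ) (k : ℕ)
    (hγ : γ ∈ Set.Ioo (0:ℝ) 1) (hc : c ∈ Set.Icc (0:ℝ) 1) (hK : 0 < K)
    (hCE0 : 0 ≤ CE) (hCEK : CE < K) (hCR : 0 ≤ CR)
    (hfmono : Monotone f) (hf01 : ∀ x, f x ∈ Set.Icc (0:ℝ) 1)
    (hk : 1 ≤ k) (hcomp : HasComplexity f k)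
    (g : ℝ → ℝ) (hopt : IsOptimal γ c CR CE K f g)
    (x : ℝ) (hgx : g x = CE) :
    ¬ ContinuousAt f x := by
  intro hcont
  have hfin := finite_range_of_complexity f k hcomp
  have hev : ∀ᶠ y in 𝓝 x, f y = f x := by
    have hcl : IsClosed (Set.range f \ {f x}) := (hfin.subset Set.sdiff_subset).isClosed
    have hmem : (Set.range f \ {f x})ᶜ ∈ 𝓝 (f x) := hcl.isOpen_compl.mem_nhds (by simp)
    filter_upwards [hcont hmem] with y hy
    by_contra hne
    exact hy ⟨⟨y, rfl⟩, hne⟩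
  obtain ⟨δ, hδ, hball⟩ := Metric.eventually_nhds_iff.1 hev
  obtain ⟨ε, hε, hεlt⟩ := exists_between (lt_min hδ (sub_pos.2 hCEK))
  have hε1 : ε < δ := lt_of_lt_of_le hεlt (min_le_left _ _)
  have hε2 : ε < K - CE := lt_of_lt_of_le hεlt (min_le_right _ _)
  have hfx : f (x - ε) = f x := hball (by
    rw [Real.dist_eq]
    have : x - ε - x = -ε := by ring
    rw [this, abs_neg, abs_of_pos hε]
    exact hε1)
  have hft : ftilde γ c f (x - ε) = ftilde γ c f x := by unfold ftilde; rw [hfx]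
  obtain ⟨q0, q1⟩ := ftilde_mem γ c f x hγ hc (hf01 x)
  have r0 : 0 ≤ γ * ftilde γ c f x := mul_nonneg hγ.1.le q0
  have r1 : γ * ftilde γ c f x < 1 := by nlinarith [hγ.1, hγ.2]
  have hgeo := summable_geometric_of_lt_one r0 r1
  -- payoff of the policy
  have htraj : ∀ n, polTraj CE g x n = x := by
    intro n
    induction n with
    | zero => rfl
    | succ n ih => simp [polTraj, ih, hgx]
  have hst : ∀ n, stTraj CE (fun _ => CE) x n = x := by
    intro n
    induction n with
    | zero => rfl
    | succ n ih => simp [stTraj, ih]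
  have hpol : polPayoff γ c CR CE f g x
      = ∑' t : ℕ, (CR + CE) * (γ * ftilde γ c f x) ^ t := by
    unfold polPayoff payoff
    simp only [htraj, hgx, hst, Finset.prod_const, Finset.card_range]
  -- the deviation
  let d : ℕ → ℝ := fun n => if n = 0 then ε else 0
  have hst' : ∀ n, stTraj CE (fun n => CE + d n) x (n + 1) = x - ε := by
    intro n
    induction n with
    | zero => simp [stTraj, d]; ring
    | succ n ih => rw [stTraj, ih]; simp [d]
  have hdev : payoff γ c CR CE f x (fun n => CE + d n)
      = ∑' t : ℕ, ((CR + CE) * (γ * ftilde γ c f x) ^ t + d t) := by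
    unfold payoff
    refine tsum_congr fun t => ?_
    simp only [hst', hft, Finset.prod_const, Finset.card_range]
    cases t with
    | zero => simp; ring
    | succ t => simp [d]
  have hd : HasSum d ε := by
    simpa [d] using hasSum_ite_eq (0 : ℕ) ε
  rw [(hgeo.mul_left (CR + CE)).tsum_add hd.summable, hd.tsum_eq, ← hpol] at hdev
  have hact : IsActionSeq K (fun n => CE + d n) := by
    intro n
    by_cases hn : n = 0
    · simp only [d, hn, if_true]; constructor <;> linarith
    · simp only [d, hn, if_false]; constructor <;> linarith
  have := hopt.2 x _ hact
  linarith
end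
end

section
/- Suppose the demand function f has complexity k for some finite k ≥ 1, and let g* be an optimal simple policy with the greedy tie-breaking property: for every x ∈ ℝ, Q(g*(x), x) = sup_{i ∈ [−K,K]} Q(i, x), and g*(x) ≥ i for every i ∈ [−K,K] with Q(i, x) = sup_{i' ∈ [−K,K]} Q(i', x). Then for every initial state x₀ ∈ ℝ, the trajectory (x_t)_{t≥1} of g* from x₁ = x₀ is monotone: either x_t ≤ x_{t+1} for all t, or x_t ≥ x_{t+1} for all t. -/
noncomputable section

open Filter Topology

theorem aux_ftilde_mem (γ c : ℝ) (f : ℝ → ℝ) (hγ : γ ∈ Set.Ioo (0:ℝ) 1)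
    (hc : c ∈ Set.Icc (0:ℝ) 1) (hf01 : ∀ x, f x ∈ Set.Icc (0:ℝ) 1) (x : ℝ) :
    0 ≤ ftilde γ c f x ∧ ftilde γ c f x ≤ 1 := by
  obtain ⟨h0, h1⟩ := hγ
  obtain ⟨c0, c1⟩ := hc
  obtain ⟨f0, f1⟩ := hf01 x
  have hcf : 0 ≤ (1 - c) * f x := mul_nonneg (by linarith) f0
  have hg : 0 ≤ γ * ((1 - c) * f x) := mul_nonneg h0.le hcf
  have hd : 0 < 1 - γ * (1 - (1 - c) * f x) := by nlinarith
  unfold ftilde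
  constructor
  · apply add_nonneg f0
    apply div_nonneg _ hd.le
    have := mul_nonneg (sub_nonneg.2 f1) hg
    nlinarith
  · have : ((1 - f x) * (1 - c) * f x * γ) / (1 - γ * (1 - (1 - c) * f x)) ≤ 1 - f x := by
      rw [div_le_iff₀ hd]
      have := mul_nonneg (sub_nonneg.2 f1) (sub_nonneg.2 h1.le)
      nlinarith
    linarith

theorem aux_payoff_le (γ c CR CE K : ℝ) (f : ℝ → ℝ) (hγ : γ ∈ Set.Ioo (0:ℝ) 1)
    (hc : c ∈ Set.Icc (0:ℝ) 1) (hCR : 0 ≤ CR)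
    (hf01 : ∀ x, f x ∈ Set.Icc (0:ℝ) 1) (x : ℝ) (a : ℕ → ℝ) (ha : IsActionSeq K a) :
    payoff γ c CR CE f x a ≤ (CR + K) * (1 - γ)⁻¹ := by
  have hs : HasSum (fun t : ℕ => (CR + K) * γ ^ t) ((CR + K) * (1 - γ)⁻¹) :=
    (hasSum_geometric_of_lt_one hγ.1.le hγ.2).mul_left _
  refine le_trans (le_abs_self _) ?_
  rw [← Real.norm_eq_abs]
  refine tsum_of_norm_bounded hs ?_
  intro t
  rw [norm_mul, Real.norm_eq_abs, Real.norm_eq_abs, Finset.abs_prod]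
  have h1 : |CR + a t| ≤ CR + K := by
    have := ha t
    rw [abs_le]; constructor <;> linarith [this.1, this.2]
  refine mul_le_mul h1 ?_ (Finset.prod_nonneg fun _ _ => abs_nonneg _)
    ((abs_nonneg _).trans h1)
  have : ∏ τ ∈ Finset.range t, |γ * ftilde γ c f (stTraj CE a x (τ + 1))|
      ≤ ∏ _τ ∈ Finset.range t, γ := by
    apply Finset.prod_le_prod
    · intro _ _; exact abs_nonneg _
    · intro τ _
      obtain ⟨h0, h1⟩ := aux_ftilde_mem γ c f hγ hc hf01 (stTraj CE a x (τ + 1))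
      rw [abs_of_nonneg (mul_nonneg hγ.1.le h0)]
      exact mul_le_of_le_one_right hγ.1.le h1
  simpa using this

theorem aux_Q_bdd (γ c CR CE K : ℝ) (f : ℝ → ℝ) (hγ : γ ∈ Set.Ioo (0:ℝ) 1)
    (hc : c ∈ Set.Icc (0:ℝ) 1) (hK : 0 < K) (hCR : 0 ≤ CR)
    (hf01 : ∀ x, f x ∈ Set.Icc (0:ℝ) 1) (x : ℝ) :
    BddAbove (Set.range fun i' : Set.Icc (-K) K => Q γ c CR CE K f i' x) := by
  set B : ℝ := (CR + K) * (1 - γ)⁻¹ with hB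
  have hB0 : 0 ≤ B := mul_nonneg (by linarith) (inv_nonneg.2 (by linarith [hγ.2]))
  have hV : ∀ y, V γ c CR CE K f y ≤ B := by
    intro y
    apply Real.sSup_le _ hB0
    rintro v ⟨a, ha, rfl⟩
    exact aux_payoff_le γ c CR CE K f hγ hc hCR hf01 y a ha
  refine ⟨CR + K + B, ?_⟩
  rintro _ ⟨i, rfl⟩
  have hi := i.2.2
  obtain ⟨h0, h1⟩ := aux_ftilde_mem γ c f hγ hc hf01 (x + CE - i)
  have hw0 : 0 ≤ γ * ftilde γ c f (x + CE - i) := mul_nonneg hγ.1.le h0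
  have hw1 : γ * ftilde γ c f (x + CE - i) ≤ 1 :=
    (mul_le_of_le_one_right hγ.1.le h1).trans hγ.2.le
  have h2 := mul_le_mul_of_nonneg_left (hV (x + CE - i)) hw0
  have h3 := mul_le_of_le_one_left hB0 hw1
  simp only [Q]
  linarith

/-- Every trajectory of the greedy-tie-breaking optimal simple policy is monotone
(either nondecreasing or nonincreasing). -/
theorem stmt7 (γ c CR CE K : ℝ) (f : ℝ → ℝ) (k : ℕ)
    (hγ : γ ∈ Set.Ioo (0:ℝ) 1) (hc : c ∈ Set.Icc (0:ℝ) 1) (hK : 0 < K)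
    (hCE0 : 0 ≤ CE) (hCEK : CE < K) (hCR : 0 ≤ CR)
    (hfmono : Monotone f) (hf01 : ∀ x, f x ∈ Set.Icc (0:ℝ) 1)
    (hk : 1 ≤ k) (hcomp : HasComplexity f k)
    (g : ℝ → ℝ) (hopt : IsOptimal γ c CR CE K f g)
    (hgreedy : ∀ x : ℝ,
      Q γ c CR CE K f (g x) x = (⨆ i' : Set.Icc (-K) K, Q γ c CR CE K f i' x) ∧
      ∀ i ∈ Set.Icc (-K) K,
        Q γ c CR CE K f i x = (⨆ i' : Set.Icc (-K) K, Q γ c CR CE K f i' x) → i ≤ g x) :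
    ∀ x0 : ℝ, Monotone (polTraj CE g x0) ∨ Antitone (polTraj CE g x0) := by
  have hle : ∀ x i, i ∈ Set.Icc (-K) K → Q γ c CR CE K f i x ≤ Q γ c CR CE K f (g x) x := by
    intro x i hi
    rw [(hgreedy x).1]
    exact le_ciSup (aux_Q_bdd γ c CR CE K f hγ hc hK hCR hf01 x) ⟨i, hi⟩
  have hshift : ∀ x x' i i', x + CE - i = x' + CE - i' →
      Q γ c CR CE K f i x - i = Q γ c CR CE K f i' x' - i' := by
    intro x x' i i' h
    simp only [Q]
    rw [h]
    ring
  have hT : Monotone (fun x => x + CE - g x) := by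
    intro x x' hxx
    by_contra hlt
    simp only [not_le] at hlt
    have hg := hopt.1 x
    have hg' := hopt.1 x'
    have hi : x - x' + g x' ∈ Set.Icc (-K) K :=
      ⟨by linarith [hg.1], by linarith [hg'.2]⟩
    have hi' : x' - x + g x ∈ Set.Icc (-K) K :=
      ⟨by linarith [hg.1], by linarith [hg'.2]⟩
    have e1 := hshift x x' (x - x' + g x') (g x') (by ring)
    have e2 := hshift x' x (x' - x + g x) (g x) (by ring)
    have l1 := hle x _ hi
    have l2 := hle x' _ hi'
    have heq : Q γ c CR CE K f (x - x' + g x') x = Q γ c CR CE K f (g x) x := by linarith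
    have := (hgreedy x).2 _ hi (heq.trans (hgreedy x).1)
    linarith
  intro x0
  rcases le_total x0 (x0 + CE - g x0) with h | h
  · left
    apply monotone_nat_of_le_succ
    intro n
    induction n with
    | zero => exact h
    | succ n ih => exact hT ih
  · right
    apply antitone_nat_of_succ_le
    intro n
    induction n with
    | zero => exact h
    | succ n ih => exact hT ih
end
end
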